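/- Let X be a compact Hausdorff topological space. The map sending a point x ∈ X to the maximal ideal m_x = {f ∈ C(X,ℝ) : f(x) = 0} is a homeomorphism from X onto the maximal spectrum of the ring C(X,ℝ) equipped with the Zariski topology. In particular, every maximal ideal of C(X,ℝ) is of the form m_x for a unique x ∈ X, and the topology induced on X from the Zariski topology via this bijection coincides with the original topology of X. -/

import Mathlib

open ContinuousMap in
/-- The maximal ideal of functions in `C(X, ℝ)` vanishing at `x`. -/
noncomputable def maximalSpectrumEval (X : Type*) [TopologicalSpace X] [CompactSpace X]
    [T2Space X] (x : X) : MaximalSpectrum C(X, ℝ) :=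
  ⟨idealOfSet ℝ {x}ᶜ, idealOf_compl_singleton_isMaximal ℝ x⟩

section

variable {X : Type*} [TopologicalSpace X] [CompactSpace X] [T2Space X]

theorem mem_maximalSpectrumEval {x : X} {f : C(X, ℝ)} :
    f ∈ (maximalSpectrumEval X x).asIdeal ↔ f x = 0 :=
  ContinuousMap.mem_idealOfSet_compl_singleton x f

theorem exists_continuousMap_eqOn_zero_ne_zero {s : Set X} (hs : IsClosed s) {x : X}
    (hx : x ∉ s) : ∃ f : C(X, ℝ), Set.EqOn f 0 s ∧ f x ≠ 0 := by
  obtain ⟨f, hf0, hf1, -⟩ := exists_continuous_zero_one_of_isClosed hs isClosed_singleton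
    (Set.disjoint_singleton_right.mpr hx)
  refine ⟨f, hf0, ?_⟩
  rw [hf1 (Set.mem_singleton x)]
  exact one_ne_zero

theorem maximalSpectrumEval_injective : Function.Injective (maximalSpectrumEval X) := by
  intro x y h
  by_contra hxy
  obtain ⟨f, hf, hfx⟩ := exists_continuousMap_eqOn_zero_ne_zero (isClosed_singleton (x := y)) hxy
  exact hfx (mem_maximalSpectrumEval.mp (h ▸ mem_maximalSpectrumEval.mpr (hf rfl)))

theorem maximalSpectrumEval_surjective : Function.Surjective (maximalSpectrumEval X) := by
  intro I
  obtain ⟨x, hx⟩ := ContinuousMap.setOfIdeal_eq_compl_singleton I.asIdeal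
  refine ⟨x, MaximalSpectrum.ext (I.isMaximal.eq_of_le
    (maximalSpectrumEval X x).isMaximal.ne_top fun f hf ↦ mem_maximalSpectrumEval.mpr ?_).symm⟩
  have hx' : x ∉ ContinuousMap.setOfIdeal I.asIdeal := by simp [hx]
  exact ContinuousMap.notMem_setOfIdeal.mp hx' hf

theorem isInducing_maximalSpectrumEval : Topology.IsInducing (maximalSpectrumEval X) := by
  have mem_zeroLocus (x : X) (t : Set C(X, ℝ)) :
      (maximalSpectrumEval X x).toPrimeSpectrum ∈ PrimeSpectrum.zeroLocus t ↔
        ∀ f ∈ t, f x = 0 :=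
    forall₂_congr fun _ _ ↦ mem_maximalSpectrumEval
  refine Topology.isInducing_iff _ |>.mpr ?_
  rw [MaximalSpectrum.zariskiTopology, induced_compose]
  refine TopologicalSpace.ext_iff_isClosed.mpr fun s ↦ ?_
  rw [isClosed_induced_iff]
  constructor
  · intro hs
    refine ⟨PrimeSpectrum.zeroLocus {f | Set.EqOn f 0 s}, PrimeSpectrum.isClosed_zeroLocus _, ?_⟩
    ext x
    refine (mem_zeroLocus x _).trans ⟨fun h ↦ ?_, fun hx f hf ↦ hf hx⟩
    by_contra hx
    obtain ⟨f, hf, hfx⟩ := exists_continuousMap_eqOn_zero_ne_zero hs hx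
    exact hfx (h f hf)
  · rintro ⟨t, ht, rfl⟩
    obtain ⟨t, rfl⟩ := (PrimeSpectrum.isClosed_iff_zeroLocus _).mp ht
    have : (MaximalSpectrum.toPrimeSpectrum ∘ maximalSpectrumEval X) ⁻¹'
        PrimeSpectrum.zeroLocus t = ⋂ f ∈ t, {x | f x = 0} := by
      ext x
      simpa using mem_zeroLocus x t
    rw [this]
    exact isClosed_biInter fun f _ ↦ isClosed_eq f.continuous continuous_const

end

/-- For a compact Hausdorff space `X`, the map sending `x : X` to the maximal ideal
`m_x = {f ∈ C(X,ℝ) : f x = 0}` is a homeomorphism from `X` onto the maximal spectrum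
of `C(X,ℝ)` equipped with the (induced) Zariski topology. -/
theorem stmt0 (X : Type*) [TopologicalSpace X] [CompactSpace X] [T2Space X] :
    letI : TopologicalSpace (MaximalSpectrum C(X, ℝ)) :=
      TopologicalSpace.induced MaximalSpectrum.toPrimeSpectrum inferInstance
    ∃ h : X ≃ₜ MaximalSpectrum C(X, ℝ),
      ∀ (x : X) (f : C(X, ℝ)), f ∈ (h x).asIdeal ↔ f x = 0 := by
  exact ⟨(Equiv.ofBijective (maximalSpectrumEval X)
    ⟨maximalSpectrumEval_injective, maximalSpectrumEval_surjective⟩).toHomeomorphOfIsInducing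
      isInducing_maximalSpectrumEval, fun _ _ ↦ mem_maximalSpectrumEval⟩
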